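/- arXiv:0903.2214 — 2 statements merged into one kernel-verified Lean document; each statement's English description precedes it below -/
import Mathlib

section
/- Let Ω ⊆ ℝ² be an open set and let f¹, f², f³ : ℝ² → ℝ be locally L^{4/3} on Ω, each fⁱ having a weak gradient gⁱ = (gⁱ₁, gⁱ₂) on Ω with gⁱ₁, gⁱ₂ locally L^{4/3} on Ω (i.e. fⁱ ∈ W^{1,4/3}_loc(Ω)). Suppose the contact system g³(x) = f¹(x)·g²(x) − f²(x)·g¹(x) holds for Lebesgue-almost every x ∈ Ω. Then for almost every x ∈ Ω every 2×2 minor of the 3×2 matrix with rows g¹(x), g²(x), g³(x) vanishes; in particular g¹₁(x)·g²₂(x) − g¹₂(x)·g²₁(x) = 0 almost everywhere, so the weak differential of f = (f¹,f²,f³) has rank at most 1 almost everywhere in Ω. -/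
open MeasureTheory
open scoped ENNReal

/-- `u ∈ W^{1,1}_loc(Ω)` with weak gradient `(g₁, g₂)`: `u`, `g₁`, `g₂` are locally
integrable on the open set `Ω ⊆ ℝ²` and the integration-by-parts identities
`∫_Ω u ∂ᵢφ = −∫_Ω gᵢ φ` hold for every smooth `φ` with compact support in `Ω`. -/
def HasWeakGradientOn (u g₁ g₂ : ℝ × ℝ → ℝ) (Ω : Set (ℝ × ℝ)) : Prop :=
  LocallyIntegrableOn u Ω volume ∧
  LocallyIntegrableOn g₁ Ω volume ∧
  LocallyIntegrableOn g₂ Ω volume ∧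
  (∀ φ : ℝ × ℝ → ℝ, ContDiff ℝ (⊤ : ℕ∞) φ → HasCompactSupport φ → tsupport φ ⊆ Ω →
    ∫ x in Ω, u x * fderiv ℝ φ x (1, 0) = -∫ x in Ω, g₁ x * φ x) ∧
  (∀ φ : ℝ × ℝ → ℝ, ContDiff ℝ (⊤ : ℕ∞) φ → HasCompactSupport φ → tsupport φ ⊆ Ω →
    ∫ x in Ω, u x * fderiv ℝ φ x (0, 1) = -∫ x in Ω, g₂ x * φ x)

open Set Filter Topology

/-- `u` is a primitive of the integrable function `p` on `[0, r]`, up to changing its values on a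
null set that avoids the endpoints. -/
def IsPrimitiveOn (u p : ℝ → ℝ) (r : ℝ) : Prop :=
  IntervalIntegrable p volume 0 r ∧ u r = u 0 + ∫ s in (0 : ℝ)..r, p s ∧
    ∀ᵐ t : ℝ, t ∈ Icc 0 r → u t = u 0 + ∫ s in (0 : ℝ)..t, p s

section WeakDerivative

variable {E : Type*} [NormedAddCommGroup E] [NormedSpace ℝ E] [MeasurableSpace E] {μ : Measure E}

/-- `g` is the weak derivative of `f` on `U` in the direction `w`, both functions being regarded
as defined on the whole space. -/
def IsWeakDirDeriv (μ : Measure E) (f g : E → ℝ) (w : E) (U : Set E) : Prop :=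
  ∀ φ : E → ℝ, ContDiff ℝ (⊤ : ℕ∞) φ → HasCompactSupport φ → tsupport φ ⊆ U →
    ∫ x, f x * fderiv ℝ φ x w ∂μ = -∫ x, g x * φ x ∂μ

theorem IsWeakDirDeriv.smul {f g : E → ℝ} {w : E} {U : Set E} (h : IsWeakDirDeriv μ f g w U)
    (t : ℝ) : IsWeakDirDeriv μ f (fun x => t * g x) (t • w) U := by
  intro φ hφ hc hs
  simp only [map_smul, smul_eq_mul, mul_left_comm _ t, mul_assoc t, integral_const_mul,
    h φ hφ hc hs, mul_neg]

variable [BorelSpace E]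

/-- The derivative of a translated test integral along the direction of a weak derivative. -/
theorem hasDerivAt_integral_mul_translate {f g : E → ℝ} (hf : Integrable f μ) {w : E} {U : Set E}
    (h : IsWeakDirDeriv μ f g w U) {φ : E → ℝ} (hφ : ContDiff ℝ (⊤ : ℕ∞) φ)
    (hc : HasCompactSupport φ) {s : ℝ} (hs : ∀ x ∈ tsupport φ, x + s • w ∈ U) :
    HasDerivAt (fun s : ℝ => ∫ y, f y * φ (y - s • w) ∂μ) (∫ y, g y * φ (y - s • w) ∂μ) s := by
  have hφ1 : Continuous (fun x => fderiv ℝ φ x w) :=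
    (hφ.continuous_fderiv (by simp)).clm_apply continuous_const
  have hc1 : HasCompactSupport (fun x => fderiv ℝ φ x w) :=
    (hc.fderiv (𝕜 := ℝ)).comp_left (g := fun L : E →L[ℝ] ℝ => L w) (by simp)
  obtain ⟨C, hC⟩ := hφ1.bounded_above_of_compact_support hc1
  obtain ⟨D, hD⟩ := hφ.continuous.bounded_above_of_compact_support hc
  have key : HasDerivAt (fun s : ℝ => ∫ y, f y * φ (y - s • w) ∂μ)
      (∫ y, f y * -(fderiv ℝ φ (y - s • w) w) ∂μ) s := by
    refine (hasDerivAt_integral_of_dominated_loc_of_deriv_le (μ := μ)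
      (F := fun (s : ℝ) y => f y * φ (y - s • w))
      (F' := fun (s : ℝ) y => f y * -(fderiv ℝ φ (y - s • w) w)) (x₀ := s) (s := univ)
      (bound := fun y => ‖f y‖ * C) univ_mem ?_ ?_ ?_ ?_ (hf.norm.mul_const C) ?_).2
    · exact Eventually.of_forall fun s => hf.1.mul
        (hφ.continuous.comp (by fun_prop)).aestronglyMeasurable
    · exact hf.mul_bdd (c := D) (hφ.continuous.comp (by fun_prop)).aestronglyMeasurable
        (Eventually.of_forall fun y => hD _)
    · exact hf.1.mul
        (hφ1.comp (by fun_prop : Continuous fun y => y - s • w)).neg.aestronglyMeasurable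
    · refine Eventually.of_forall fun y s _ => ?_
      rw [norm_mul, norm_neg]
      exact mul_le_mul_of_nonneg_left (hC _) (norm_nonneg _)
    · refine Eventually.of_forall fun y s _ => HasDerivAt.const_mul _ ?_
      have h1 : HasDerivAt (fun s : ℝ => y - s • w) (-w) s := by
        simpa using ((hasDerivAt_id s).smul_const w).const_sub y
      have h2 := ((hφ.differentiable (by simp)) (y - s • w)).hasFDerivAt.comp_hasDerivAt s h1
      simpa only [map_neg, Function.comp_def] using h2
  convert key using 1
  have hφs : ContDiff ℝ (⊤ : ℕ∞) (fun y => φ (y - s • w)) := hφ.comp (by fun_prop)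
  have hcs : HasCompactSupport (fun y => φ (y - s • w)) :=
    hc.comp_homeomorph (Homeomorph.subRight (s • w))
  have hts : tsupport (fun y => φ (y - s • w)) ⊆ U := by
    intro y hy
    have : y - s • w ∈ tsupport φ :=
      tsupport_comp_subset_preimage φ (f := fun y => y - s • w) (by fun_prop) hy
    simpa using hs _ this
  have := h _ hφs hcs hts
  simp only [fderiv_comp_sub] at this
  simp only [mul_neg, integral_neg]
  rw [this, neg_neg]

variable [FiniteDimensional ℝ E] [μ.IsAddHaarMeasure]

/-- The shear `(x, t) ↦ (x + t • w, t)` preserves the product of a translation-invariant measure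
with a measure on the line. -/
theorem measurePreserving_add_smul_prod (μ : Measure E) [μ.IsAddHaarMeasure] (ν : Measure ℝ)
    [SFinite ν] (w : E) :
    MeasurePreserving (fun p : E × ℝ => (p.1 + p.2 • w, p.2)) (μ.prod ν) (μ.prod ν) := by
  have h : MeasurePreserving (fun p : ℝ × E => (p.1, p.2 + p.1 • w)) (ν.prod μ) (ν.prod μ) :=
    (MeasurePreserving.id ν).skew_product (g := fun t x => x + t • w)
      (by fun_prop) (Eventually.of_forall fun t => map_add_right_eq_self μ (t • w))
  exact (Measure.measurePreserving_swap.comp h).comp Measure.measurePreserving_swap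

theorem MeasureTheory.Integrable.comp_add_smul_prod {g : E → ℝ} (hg : Integrable g μ)
    (ν : Measure ℝ) [IsFiniteMeasure ν] (w : E) :
    Integrable (fun p : E × ℝ => g (p.1 + p.2 • w)) (μ.prod ν) :=
  (measurePreserving_add_smul_prod μ ν w).integrable_comp_of_integrable (hg.comp_fst ν)

theorem MeasureTheory.Integrable.ae_intervalIntegrable_ray {g : E → ℝ} (hg : Integrable g μ)
    {r : ℝ} (hr : 0 ≤ r) (w : E) :
    ∀ᵐ x ∂μ, IntervalIntegrable (fun t => g (x + t • w)) volume 0 r := by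
  filter_upwards [(hg.comp_add_smul_prod (volume.restrict (Ioc (0 : ℝ) r)) w).prod_right_ae]
    with x hx
  rwa [intervalIntegrable_iff_integrableOn_Ioc_of_le hr]

theorem ae_ae_add_smul {P : E → Prop} (hP : ∀ᵐ x ∂μ, P x) (w : E) :
    ∀ᵐ x ∂μ, ∀ᵐ t : ℝ, P (x + t • w) :=
  Measure.ae_ae_of_ae_prod <| (measurePreserving_add_smul_prod μ volume w).quasiMeasurePreserving.ae
    (Measure.quasiMeasurePreserving_fst.ae hP)

/-- The fundamental theorem of calculus along almost every segment in the direction of a weak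
derivative. -/
theorem IsWeakDirDeriv.ae_sub_eq_integral {f g : E → ℝ} (hf : Integrable f μ)
    (hg : Integrable g μ) {w : E} {U V : Set E} (hV : IsOpen V)
    (h : IsWeakDirDeriv μ f g w U) (hVU : ∀ x ∈ V, ∀ s ∈ Icc (0 : ℝ) 1, x + s • w ∈ U) :
    ∀ᵐ x ∂μ, x ∈ V → f (x + w) - f x - ∫ s in (0 : ℝ)..1, g (x + s • w) = 0 := by
  have hprod := hg.comp_add_smul_prod (volume.restrict (Ioc (0 : ℝ) 1)) w
  have hint : Integrable (fun x => ∫ s in (0 : ℝ)..1, g (x + s • w)) μ := by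
    simp only [intervalIntegral.integral_of_le zero_le_one]
    exact hprod.integral_prod_left
  refine hV.ae_eq_zero_of_integral_contDiff_smul_eq_zero
    ((((hf.comp_add_right w).sub hf).sub hint).locallyIntegrable.locallyIntegrableOn V) ?_
  intro φ hφ hc hs
  obtain ⟨D, hD⟩ := hφ.continuous.bounded_above_of_compact_support hc
  have hφm : AEStronglyMeasurable φ μ := hφ.continuous.aestronglyMeasurable
  have hder : ∀ s ∈ uIcc (0 : ℝ) 1, HasDerivAt (fun s : ℝ => ∫ y, f y * φ (y - s • w) ∂μ)
      (∫ y, g y * φ (y - s • w) ∂μ) s := fun s hs' =>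
    hasDerivAt_integral_mul_translate hf h hφ hc fun x hx =>
      hVU x (hs hx) s (by simpa using hs')
  have hshift : ∀ (s : ℝ) (k : E → ℝ),
      ∫ y, k y * φ (y - s • w) ∂μ = ∫ x, φ x * k (x + s • w) ∂μ := by
    intro s k
    rw [← integral_add_right_eq_self _ (s • w)]
    simp [mul_comm]
  have hprodφ : Integrable (fun p : E × ℝ => φ p.1 * g (p.1 + p.2 • w))
      (μ.prod (volume.restrict (Ioc (0 : ℝ) 1))) :=
    hprod.bdd_mul (c := D) (hφ.continuous.comp continuous_fst).aestronglyMeasurable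
      (Eventually.of_forall fun _ => hD _)
  have hii : IntervalIntegrable (fun s : ℝ => ∫ y, g y * φ (y - s • w) ∂μ) volume 0 1 := by
    rw [intervalIntegrable_iff_integrableOn_Ioc_of_le zero_le_one]
    simp only [hshift]
    exact hprodφ.integral_prod_right
  have hftc := intervalIntegral.integral_eq_sub_of_hasDerivAt hder hii
  rw [hshift, hshift] at hftc
  simp only [hshift, one_smul, zero_smul, add_zero] at hftc
  rw [intervalIntegral.integral_of_le zero_le_one, ← integral_integral_swap hprodφ] at hftc
  simp only [integral_const_mul] at hftc
  have i1 : Integrable (fun x => φ x * f (x + w)) μ :=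
    (hf.comp_add_right w).bdd_mul (c := D) hφm (Eventually.of_forall fun _ => hD _)
  have i2 : Integrable (fun x => φ x * f x) μ :=
    hf.bdd_mul (c := D) hφm (Eventually.of_forall fun _ => hD _)
  have i3 : Integrable (fun x => φ x * ∫ s in (0 : ℝ)..1, g (x + s • w)) μ :=
    hint.bdd_mul (c := D) hφm (Eventually.of_forall fun _ => hD _)
  simp only [smul_eq_mul, mul_sub]
  rw [integral_sub (by exact i1.sub i2) i3, integral_sub i1 i2]
  simp only [intervalIntegral.integral_of_le zero_le_one]
  rw [hftc, sub_self]

/-- Absolute continuity on almost every line: for almost every starting point, `f` is given along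
the ray in the direction `w` by integrating its weak derivative. -/
theorem IsWeakDirDeriv.ae_ray {f g : E → ℝ} (hf : Integrable f μ) (hg : Integrable g μ)
    (hfm : Measurable f) (hgm : Measurable g) {w : E} {U V : Set E} (hV : IsOpen V)
    (h : IsWeakDirDeriv μ f g w U) {r : ℝ} (hr : 0 ≤ r)
    (hVU : ∀ x ∈ V, ∀ s ∈ Icc (0 : ℝ) r, x + s • w ∈ U) :
    ∀ᵐ x ∂μ, x ∈ V → IsPrimitiveOn (fun t => f (x + t • w)) (fun t => g (x + t • w)) r := by
  have hfix : ∀ t ∈ Icc 0 r, ∀ᵐ x ∂μ, x ∈ V →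
      f (x + t • w) = f x + ∫ s in (0 : ℝ)..1, t * g (x + (s * t) • w) := by
    intro t ht
    filter_upwards [(h.smul t).ae_sub_eq_integral hf (hg.const_mul t) hV
      (fun x hx s hs => by
        rw [smul_smul]
        exact hVU x hx _ ⟨mul_nonneg hs.1 ht.1,
          (mul_le_of_le_one_left ht.1 hs.2).trans ht.2⟩)] with x hx hxV
    have := hx hxV
    simp only [smul_smul] at this
    linarith
  have hsubst : ∀ (x : E) (t : ℝ), ∫ s in (0 : ℝ)..1, t * g (x + (s * t) • w) =
      ∫ s in (0 : ℝ)..t, g (x + s • w) := by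
    intro x t
    rw [intervalIntegral.integral_const_mul,
      intervalIntegral.mul_integral_comp_mul_right (f := fun s => g (x + s • w))]
    simp
  have hmeas : MeasurableSet {p : E × ℝ | p.1 ∈ V → p.2 ∈ Icc 0 r →
      f (p.1 + p.2 • w) = f p.1 + ∫ s in (0 : ℝ)..1, p.2 * g (p.1 + (s * p.2) • w)} := by
    refine MeasurableSet.imp (measurable_fst hV.measurableSet)
      (MeasurableSet.imp (measurable_snd measurableSet_Icc) (measurableSet_eq_fun ?_ ?_))
    · exact hfm.comp (by fun_prop)
    · refine (hfm.comp measurable_fst).add ?_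
      simp only [intervalIntegral.integral_of_le zero_le_one]
      refine (StronglyMeasurable.integral_prod_right' (f := fun q : (E × ℝ) × ℝ =>
        q.1.2 * g (q.1.1 + (q.2 * q.1.2) • w)) ?_).measurable
      exact (Measurable.mul (by fun_prop) (hgm.comp (by fun_prop))).stronglyMeasurable
  have hae : ∀ᵐ x ∂μ, ∀ᵐ t : ℝ, x ∈ V → t ∈ Icc 0 r →
      f (x + t • w) = f x + ∫ s in (0 : ℝ)..1, t * g (x + (s * t) • w) := by
    rw [Measure.ae_ae_comm hmeas]
    refine Eventually.of_forall fun t => ?_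
    by_cases ht : t ∈ Icc 0 r
    · filter_upwards [hfix t ht] with x hx hxV _ using hx hxV
    · exact Eventually.of_forall fun x _ h => absurd h ht
  filter_upwards [hg.ae_intervalIntegrable_ray hr w, hfix r ⟨hr, le_rfl⟩, hae] with x h1 h2 h3 hxV
  refine ⟨h1, by simp only [h2 hxV, hsubst, zero_smul, add_zero], ?_⟩
  filter_upwards [h3] with t ht htr
  simp only [ht hxV htr, hsubst, zero_smul, add_zero]

end WeakDerivative

section Side

/-- Comparison of `∫ u q` on `[0, r]`, where `u` is a primitive of `p`, with its value for constant
`p = a` and `q = a'`. -/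
theorem abs_integral_primitive_mul_sub_le {p q : ℝ → ℝ} {r M e a a' b c : ℝ} (hr : 0 ≤ r)
    (hp : IntervalIntegrable p volume 0 r) (hq : IntervalIntegrable q volume 0 r)
    (ha : |a| ≤ M) (ha' : |a'| ≤ M) (hb : |b| ≤ M * r) (hc : |c - b| ≤ e)
    (hpa : ∫ t in (0 : ℝ)..r, |p t - a| ≤ e) (hqa : ∫ t in (0 : ℝ)..r, |q t - a'| ≤ e) :
    IntervalIntegrable (fun t => (c + ∫ s in (0 : ℝ)..t, p s) * q t) volume 0 r ∧
    |(∫ t in (0 : ℝ)..r, (c + ∫ s in (0 : ℝ)..t, p s) * q t) - (b * r + a * r ^ 2 / 2) * a'| ≤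
      4 * M * r * e + 2 * e ^ 2 := by
  have hcont : ContinuousOn (fun t => c + ∫ s in (0 : ℝ)..t, p s) (uIcc 0 r) :=
    continuousOn_const.add (intervalIntegral.continuousOn_primitive_interval'
      hp left_mem_uIcc)
  have hint := hq.continuousOn_mul hcont
  refine ⟨hint, ?_⟩
  have hM : 0 ≤ M := (abs_nonneg _).trans ha
  have he : 0 ≤ e := (abs_nonneg _).trans hc
  have hlin : ∫ t in (0 : ℝ)..r, (b + a * t) * a' = (b * r + a * r ^ 2 / 2) * a' := by
    rw [intervalIntegral.integral_mul_const, intervalIntegral.integral_add (by simp)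
      (by exact (continuous_const.mul continuous_id).intervalIntegrable _ _),
      intervalIntegral.integral_const_mul, integral_id]
    simp
    ring_nf
    simp
  have hpd : IntervalIntegrable (fun t => |p t - a|) volume 0 r :=
    (hp.sub intervalIntegrable_const).abs
  have hqd : IntervalIntegrable (fun t => |q t - a'|) volume 0 r :=
    (hq.sub intervalIntegrable_const).abs
  have hdev : ∀ t ∈ Icc 0 r, |c + (∫ s in (0 : ℝ)..t, p s) - (b + a * t)| ≤ 2 * e := by
    intro t ht
    have hpt : IntervalIntegrable p volume 0 t := hp.mono_set (by
      rw [uIcc_of_le ht.1, uIcc_of_le hr]; exact Icc_subset_Icc_right ht.2)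
    have h1 : (∫ s in (0 : ℝ)..t, p s) - a * t = ∫ s in (0 : ℝ)..t, (p s - a) := by
      rw [intervalIntegral.integral_sub hpt intervalIntegrable_const]
      simp [mul_comm]
    have h2 : |∫ s in (0 : ℝ)..t, (p s - a)| ≤ e :=
      (intervalIntegral.abs_integral_le_integral_abs ht.1).trans
        ((intervalIntegral.integral_mono_interval le_rfl ht.1 ht.2
          (Eventually.of_forall fun s => abs_nonneg _) hpd).trans hpa)
    calc _ = |(c - b) + ((∫ s in (0 : ℝ)..t, p s) - a * t)| := by ring_nf
      _ ≤ |c - b| + |(∫ s in (0 : ℝ)..t, p s) - a * t| := abs_add_le _ _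
      _ ≤ 2 * e := by rw [h1]; linarith
  have hlini : IntervalIntegrable (fun t => (b + a * t) * a') volume 0 r :=
    (by fun_prop : Continuous fun t => (b + a * t) * a').intervalIntegrable _ _
  rw [← hlin, ← intervalIntegral.integral_sub hint hlini, ← Real.norm_eq_abs]
  have hbound : ∀ t ∈ Ioc 0 r, ‖(c + ∫ s in (0 : ℝ)..t, p s) * q t - (b + a * t) * a'‖ ≤
      (2 * M * r + 2 * e) * |q t - a'| + 2 * e * M := by
    intro t ht
    have ht' : t ∈ Icc 0 r := Ioc_subset_Icc_self ht
    have h1 := hdev t ht'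
    have h2 : |b + a * t| ≤ 2 * M * r := by
      have : |a * t| ≤ M * r := by
        rw [abs_mul, abs_of_nonneg ht'.1]
        exact mul_le_mul ha ht'.2 ht'.1 hM
      linarith [abs_add_le b (a * t)]
    rw [Real.norm_eq_abs]
    set v := c + ∫ s in (0 : ℝ)..t, p s
    calc |v * q t - (b + a * t) * a'|
        = |(b + a * t) * (q t - a') + (v - (b + a * t)) * (q t - a') + (v - (b + a * t)) * a'| := by
          ring_nf
      _ ≤ |b + a * t| * |q t - a'| + |v - (b + a * t)| * |q t - a'| + |v - (b + a * t)| * |a'| := by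
          simp only [← abs_mul]
          exact abs_add_three _ _ _
      _ ≤ 2 * M * r * |q t - a'| + 2 * e * |q t - a'| + 2 * e * M := by gcongr
      _ = _ := by ring
  refine (intervalIntegral.norm_integral_le_of_norm_le hr (Eventually.of_forall hbound)
    ((hqd.const_mul _).add intervalIntegrable_const)).trans ?_
  rw [intervalIntegral.integral_add (hqd.const_mul _) intervalIntegrable_const,
    intervalIntegral.integral_const_mul]
  have : (2 * M * r + 2 * e) * ∫ t in (0 : ℝ)..r, |q t - a'| ≤ (2 * M * r + 2 * e) * e := by
    gcongr
  simp only [intervalIntegral.integral_const, smul_eq_mul, sub_zero]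
  nlinarith

/-- A horizontal curve over `[0, r]` whose first two components have nearly constant speed
`(a₁, a₂)`: its height gain, measured from the base point `(F₁, F₂)`, is nearly
`r (b₁ a₂ - b₂ a₁)`. -/
theorem abs_contact_increment_sub_le {u₁ u₂ u₃ p₁ p₂ p₃ : ℝ → ℝ}
    {r M e a₁ a₂ b₁ b₂ F₁ F₂ : ℝ} (hr : 0 ≤ r)
    (h₁ : IsPrimitiveOn u₁ p₁ r) (h₂ : IsPrimitiveOn u₂ p₂ r) (h₃ : IsPrimitiveOn u₃ p₃ r)
    (hcontact : ∀ᵐ t : ℝ, t ∈ Icc 0 r → p₃ t = u₁ t * p₂ t - u₂ t * p₁ t)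
    (ha₁ : |a₁| ≤ M) (ha₂ : |a₂| ≤ M) (hb₁ : |b₁| ≤ M * r) (hb₂ : |b₂| ≤ M * r)
    (hc₁ : |u₁ 0 - F₁ - b₁| ≤ e) (hc₂ : |u₂ 0 - F₂ - b₂| ≤ e)
    (hp₁ : ∫ t in (0 : ℝ)..r, |p₁ t - a₁| ≤ e) (hp₂ : ∫ t in (0 : ℝ)..r, |p₂ t - a₂| ≤ e) :
    |(u₃ r - u₃ 0) - F₁ * (u₂ r - u₂ 0) + F₂ * (u₁ r - u₁ 0) - r * (b₁ * a₂ - b₂ * a₁)| ≤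
      8 * M * r * e + 4 * e ^ 2 := by
  obtain ⟨hi, hI⟩ := abs_integral_primitive_mul_sub_le hr h₁.1 h₂.1 ha₁ ha₂ hb₁ hc₁ hp₁ hp₂
  obtain ⟨hj, hJ⟩ := abs_integral_primitive_mul_sub_le hr h₂.1 h₁.1 ha₂ ha₁ hb₂ hc₂ hp₂ hp₁
  have h3 : ∫ t in (0 : ℝ)..r, p₃ t = ∫ t in (0 : ℝ)..r,
      ((((u₁ 0 - F₁ + ∫ s in (0 : ℝ)..t, p₁ s) * p₂ t) -
        ((u₂ 0 - F₂ + ∫ s in (0 : ℝ)..t, p₂ s) * p₁ t)) + (F₁ * p₂ t - F₂ * p₁ t)) := by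
    refine intervalIntegral.integral_congr_ae ?_
    filter_upwards [hcontact, h₁.2.2, h₂.2.2] with t ht ht1 ht2 htr
    rw [uIoc_of_le hr] at htr
    have htr' := Ioc_subset_Icc_self htr
    rw [ht htr', ht1 htr', ht2 htr']
    ring
  rw [intervalIntegral.integral_add (hi.sub hj) ((h₂.1.const_mul _).sub (h₁.1.const_mul _)),
    intervalIntegral.integral_sub hi hj,
    intervalIntegral.integral_sub (h₂.1.const_mul _) (h₁.1.const_mul _),
    intervalIntegral.integral_const_mul, intervalIntegral.integral_const_mul] at h3
  rw [h₁.2.1, h₂.2.1, h₃.2.1, h3]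
  rw [abs_le] at hI hJ ⊢
  constructor <;> nlinarith

end Side

section Selection

variable {E : Type*} [NormedAddCommGroup E] [NormedSpace ℝ E] [FiniteDimensional ℝ E]
  [MeasurableSpace E] [BorelSpace E] {μ : Measure E} [μ.IsAddHaarMeasure]

theorem integrable_and_integral_ray {H : E → ℝ} (hH : Integrable H μ) {r : ℝ} (hr : 0 ≤ r)
    (v w : E) :
    Integrable (fun x => ∫ t in (0 : ℝ)..r, H (x + v + t • w)) μ ∧
      ∫ x, (∫ t in (0 : ℝ)..r, H (x + v + t • w)) ∂μ = r * ∫ x, H x ∂μ := by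
  have hp := (hH.comp_add_right v).comp_add_smul_prod (volume.restrict (Ioc (0 : ℝ) r)) w
  simp only [add_right_comm _ v, intervalIntegral.integral_of_le hr]
  refine ⟨hp.integral_prod_left, ?_⟩
  rw [integral_integral_swap hp]
  have : ∀ t : ℝ, ∫ x, H (x + t • w + v) ∂μ = ∫ x, H x ∂μ := fun t => by
    simp only [add_assoc]
    exact integral_add_right_eq_self H _
  simp [this, hr]

/-- Some point of a set `B` avoiding a given null set has small integrals of `H` along the
four sides of the parallelogram spanned there by `r • v` and `r • w`. -/
theorem exists_parallelogram_integral_le {H : E → ℝ} (hH : Integrable H μ) (hH0 : ∀ x, 0 ≤ H x)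
    {r : ℝ} (hr : 0 ≤ r) (v w : E) {B : Set E} (hB0 : μ B ≠ 0) (hB : μ B ≠ ∞)
    (hBm : MeasurableSet B) {P : E → Prop} (hP : ∀ᵐ x ∂μ, P x) :
    ∃ x ∈ B, P x ∧ ∃ e : ℝ, e * μ.real B ≤ 4 * r * ∫ x, H x ∂μ ∧
      ∫ t in (0 : ℝ)..r, H (x + t • v) ≤ e ∧ ∫ t in (0 : ℝ)..r, H (x + t • w) ≤ e ∧
      ∫ t in (0 : ℝ)..r, H (x + r • v + t • w) ≤ e ∧
      ∫ t in (0 : ℝ)..r, H (x + r • w + t • v) ≤ e := by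
  have h1 := integrable_and_integral_ray hH hr 0 v
  have h2 := integrable_and_integral_ray hH hr 0 w
  have h3 := integrable_and_integral_ray hH hr (r • v) w
  have h4 := integrable_and_integral_ray hH hr (r • w) v
  simp only [add_zero] at h1 h2
  have hpos : ∀ y z : E, 0 ≤ ∫ t in (0 : ℝ)..r, H (y + t • z) := fun y z =>
    intervalIntegral.integral_nonneg hr fun t _ => hH0 _
  set T : E → ℝ := fun x => (∫ t in (0 : ℝ)..r, H (x + t • v)) +
    (∫ t in (0 : ℝ)..r, H (x + t • w)) + (∫ t in (0 : ℝ)..r, H (x + r • v + t • w)) +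
    ∫ t in (0 : ℝ)..r, H (x + r • w + t • v) with hT
  have hTi : Integrable T μ := ((h1.1.add h2.1).add h3.1).add h4.1
  have hT0 : ∀ x, 0 ≤ T x := fun x => by
    simp only [hT]
    linarith [hpos x v, hpos x w, hpos (x + r • v) w, hpos (x + r • w) v]
  have hTint : ∫ x, T x ∂μ = 4 * r * ∫ x, H x ∂μ := by
    rw [hT, integral_add (by exact (h1.1.add h2.1).add h3.1) h4.1,
      integral_add (by exact h1.1.add h2.1) h3.1, integral_add h1.1 h2.1, h1.2, h2.2, h3.2, h4.2]
    ring
  have hbad : (μ.restrict B) {x | ¬(x ∈ B ∧ P x)} = 0 := by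
    have : ∀ᵐ x ∂μ.restrict B, x ∈ B ∧ P x :=
      (ae_restrict_mem hBm).and (ae_restrict_of_ae hP)
    exact this
  have : IsFiniteMeasure (μ.restrict B) := isFiniteMeasure_restrict.2 hB
  have hBr : 0 < μ.real B := ENNReal.toReal_pos hB0 hB
  obtain ⟨x, hx, hxT⟩ := exists_notMem_null_le_average
    (by simpa [Measure.restrict_eq_zero] using hB0) hTi.restrict hbad
  simp only [mem_ofPred_eq, not_not] at hx
  refine ⟨x, hx.1, hx.2, T x, ?_, ?_⟩
  · rw [setAverage_eq, smul_eq_mul] at hxT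
    calc T x * μ.real B ≤ ((μ.real B)⁻¹ * ∫ x in B, T x ∂μ) * μ.real B := by gcongr
      _ = ∫ x in B, T x ∂μ := by field_simp
      _ ≤ ∫ x, T x ∂μ := setIntegral_le_integral hTi (Eventually.of_forall hT0)
      _ = _ := hTint
  · simp only [hT]
    have a1 := hpos x v
    have a2 := hpos x w
    have a3 := hpos (x + r • v) w
    have a4 := hpos (x + r • w) v
    refine ⟨?_, ?_, ?_, ?_⟩ <;> linarith

end Selection

section Plane

/-- At a point where the gradients are approximately continuous, a horizontal map into the
Heisenberg group has degenerate horizontal gradient. -/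
theorem det_eq_zero_of_tendsto_average {U : Set (ℝ × ℝ)} (hU : IsOpen U)
    {f₁ f₂ f₃ g₁₁ g₁₂ g₂₁ g₂₂ g₃₁ g₃₂ : ℝ × ℝ → ℝ}
    (hf : ∀ f ∈ [f₁, f₂, f₃], Integrable f ∧ Measurable f)
    (hg : ∀ g ∈ [g₁₁, g₁₂, g₂₁, g₂₂, g₃₁, g₃₂], Integrable g ∧ Measurable g)
    (h₁₁ : IsWeakDirDeriv volume f₁ g₁₁ (1, 0) U) (h₁₂ : IsWeakDirDeriv volume f₁ g₁₂ (0, 1) U)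
    (h₂₁ : IsWeakDirDeriv volume f₂ g₂₁ (1, 0) U) (h₂₂ : IsWeakDirDeriv volume f₂ g₂₂ (0, 1) U)
    (h₃₁ : IsWeakDirDeriv volume f₃ g₃₁ (1, 0) U) (h₃₂ : IsWeakDirDeriv volume f₃ g₃₂ (0, 1) U)
    (hcontact : ∀ᵐ x, x ∈ U →
      g₃₁ x = f₁ x * g₂₁ x - f₂ x * g₁₁ x ∧ g₃₂ x = f₁ x * g₂₂ x - f₂ x * g₁₂ x)
    {z : ℝ × ℝ} (hz : z ∈ U) {G : ℝ × ℝ → ℝ × ℝ × ℝ × ℝ}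
    (hG : G = fun x => (g₁₁ x, g₁₂ x, g₂₁ x, g₂₂ x))
    (hleb : Tendsto (fun r : ℝ => ⨍ y in Metric.closedBall z r, ‖G y - G z‖) (𝓝[>] 0) (𝓝 0)) :
    g₁₁ z * g₂₂ z - g₁₂ z * g₂₁ z = 0 := by
  simp only [List.mem_cons, List.not_mem_nil, or_false, forall_eq_or_imp, forall_eq] at hf hg
  obtain ⟨⟨f1i, f1m⟩, ⟨f2i, f2m⟩, f3i, f3m⟩ := hf
  obtain ⟨⟨g11i, g11m⟩, ⟨g12i, g12m⟩, ⟨g21i, g21m⟩, ⟨g22i, g22m⟩, ⟨g31i, g31m⟩, g32i, g32m⟩ := hg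
  have hGi : Integrable G := by
    rw [hG]; exact g11i.prodMk (g12i.prodMk (g21i.prodMk g22i))
  set M := ‖G z‖ with hM
  have hcomp : ∀ a b c d : ℝ, |a| ≤ ‖(a, b, c, d)‖ ∧ |b| ≤ ‖(a, b, c, d)‖ ∧
      |c| ≤ ‖(a, b, c, d)‖ ∧ |d| ≤ ‖(a, b, c, d)‖ := by
    intro a b c d
    simp [Prod.norm_def]
  have hbounds : |g₁₁ z| ≤ M ∧ |g₁₂ z| ≤ M ∧ |g₂₁ z| ≤ M ∧ |g₂₂ z| ≤ M := by
    rw [hM, hG]; exact hcomp _ _ _ _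
  obtain ⟨hM11, hM12, hM21, hM22⟩ := hbounds
  have hM0 : 0 ≤ M := norm_nonneg _
  have hdev : ∀ y, |g₁₁ y - g₁₁ z| ≤ ‖G y - G z‖ ∧ |g₁₂ y - g₁₂ z| ≤ ‖G y - G z‖ ∧
      |g₂₁ y - g₂₁ z| ≤ ‖G y - G z‖ ∧ |g₂₂ y - g₂₂ z| ≤ ‖G y - G z‖ := by
    intro y
    rw [hG]; exact hcomp _ _ _ _
  suffices hε : ∀ ε : ℝ, 0 < ε →
      |g₁₁ z * g₂₂ z - g₁₂ z * g₂₁ z| ≤ 16 * M * (36 * ε) + 8 * (36 * ε) ^ 2 by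
    have hlim : Tendsto (fun ε : ℝ => 16 * M * (36 * ε) + 8 * (36 * ε) ^ 2) (𝓝[>] 0) (𝓝 0) := by
      have : Continuous (fun ε : ℝ => 16 * M * (36 * ε) + 8 * (36 * ε) ^ 2) := by fun_prop
      simpa using (this.tendsto 0).mono_left nhdsWithin_le_nhds
    exact abs_nonpos_iff.1 (ge_of_tendsto hlim (eventually_mem_nhdsWithin.mono hε))
  intro ε hε
  obtain ⟨ρ, hρ, hρU⟩ := Metric.isOpen_iff.1 hU z hz
  obtain ⟨r, hr, hrρ, hravg⟩ : ∃ r : ℝ, 0 < r ∧ 4 * r < ρ ∧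
      ⨍ y in Metric.closedBall z (3 * r), ‖G y - G z‖ < ε := by
    have h3 : Tendsto (fun r : ℝ => 3 * r) (𝓝[>] 0) (𝓝[>] 0) := by
      refine tendsto_nhdsWithin_iff.2 ⟨?_, ?_⟩
      · have : Continuous (fun r : ℝ => 3 * r) := by fun_prop
        simpa using (this.tendsto 0).mono_left nhdsWithin_le_nhds
      · filter_upwards [self_mem_nhdsWithin] with r hr
        simpa using hr
    have e1 := (hleb.comp h3).eventually (gt_mem_nhds hε)
    have e2 : ∀ᶠ r : ℝ in 𝓝[>] 0, r < ρ / 4 :=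
      nhdsWithin_le_nhds (gt_mem_nhds (by positivity))
    obtain ⟨r, ⟨h1, h2⟩, h3⟩ := ((e1.and e2).and self_mem_nhdsWithin).exists
    exact ⟨r, h3, by linarith, h1⟩
  set V : Set (ℝ × ℝ) := Metric.ball z (3 * r) with hVdef
  have hV : IsOpen V := Metric.isOpen_ball
  have n1 : ‖((1, 0) : ℝ × ℝ)‖ = 1 := by simp [Prod.norm_def]
  have n2 : ‖((0, 1) : ℝ × ℝ)‖ = 1 := by simp [Prod.norm_def]
  have hstep : ∀ {w : ℝ × ℝ}, ‖w‖ = 1 → ∀ {x : ℝ × ℝ} {k : ℝ}, dist x z ≤ k →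
      ∀ t ∈ Icc 0 r, dist (x + t • w) z ≤ k + r := by
    intro w hw x k hx t ht
    calc dist (x + t • w) z ≤ dist (x + t • w) x + dist x z := dist_triangle _ _ _
      _ ≤ r + k := by
        gcongr
        rw [dist_self_add_left, norm_smul, hw, mul_one, Real.norm_of_nonneg ht.1]
        exact ht.2
      _ = k + r := add_comm _ _
  have hVU : ∀ {w : ℝ × ℝ}, ‖w‖ = 1 → ∀ x ∈ V, ∀ t ∈ Icc 0 r, x + t • w ∈ U := by
    intro w hw x hx t ht
    refine hρU (Metric.mem_ball.2 ?_)
    linarith [hstep hw (Metric.mem_ball.1 hx).le t ht]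
  have q11 := h₁₁.ae_ray f1i g11i f1m g11m hV hr.le (hVU n1)
  have q12 := h₁₂.ae_ray f1i g12i f1m g12m hV hr.le (hVU n2)
  have q21 := h₂₁.ae_ray f2i g21i f2m g21m hV hr.le (hVU n1)
  have q22 := h₂₂.ae_ray f2i g22i f2m g22m hV hr.le (hVU n2)
  have q31 := h₃₁.ae_ray f3i g31i f3m g31m hV hr.le (hVU n1)
  have q32 := h₃₂.ae_ray f3i g32i f3m g32m hV hr.le (hVU n2)
  have qc1 := ae_ae_add_smul hcontact (1, 0)
  have qc2 := ae_ae_add_smul hcontact (0, 1)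
  set B₃ := Metric.closedBall z (3 * r) with hB₃
  have hHon : IntegrableOn (fun y => ‖G y - G z‖) B₃ :=
    (hGi.integrableOn.sub (integrableOn_const (isCompact_closedBall _ _).measure_ne_top)).norm
  set H := B₃.indicator fun y => ‖G y - G z‖ with hH
  have hHi : Integrable H :=
    hHon.integrable_indicator Metric.isClosed_closedBall.measurableSet
  have qH1 := hHi.ae_intervalIntegrable_ray hr.le (1, 0)
  have qH2 := hHi.ae_intervalIntegrable_ray hr.le (0, 1)
  have good := (q11.and (q21.and (q31.and (qc1.and qH1)))).and
    (q12.and (q22.and (q32.and (qc2.and qH2))))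
  have shift : ∀ v : ℝ × ℝ, ∀ {P : ℝ × ℝ → Prop}, (∀ᵐ x, P x) → ∀ᵐ x, P (x + v) :=
    fun v P hP => (measurePreserving_add_right volume v).quasiMeasurePreserving.ae hP
  obtain ⟨x, hxB, ⟨gx, gxv, gxw⟩, e, he, e1, e2, e3, e4⟩ := exists_parallelogram_integral_le hHi
    (fun y => indicator_nonneg (fun _ _ => norm_nonneg _) y) hr.le ((1, 0) : ℝ × ℝ) (0, 1)
    (B := Metric.closedBall z r) (Metric.measure_closedBall_pos volume z hr).ne'
    (isCompact_closedBall _ _).measure_ne_top Metric.isClosed_closedBall.measurableSet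
    (good.and ((shift (r • (1, 0)) good).and (shift (r • (0, 1)) good)))
  have heε : e ≤ 36 * ε * r := by
    rw [integral_indicator Metric.isClosed_closedBall.measurableSet] at he
    rw [setAverage_eq, smul_eq_mul] at hravg
    have hvol : volume.real B₃ = 9 * volume.real (Metric.closedBall z r) := by
      rw [hB₃, Measure.addHaar_real_closedBall _ _ (by positivity),
        Measure.addHaar_real_closedBall _ _ hr.le]
      simp only [Module.finrank_prod, Module.finrank_self]
      ring
    have hb : 0 < volume.real (Metric.closedBall z r) :=
      ENNReal.toReal_pos (Metric.measure_closedBall_pos volume z hr).ne'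
        (isCompact_closedBall _ _).measure_ne_top
    rw [hvol, inv_mul_lt_iff₀ (by positivity)] at hravg
    refine le_of_mul_le_mul_right ?_ hb
    nlinarith
  have hxz : dist x z ≤ r := hxB
  have he0 : 0 ≤ e := le_trans (intervalIntegral.integral_nonneg hr.le fun t _ =>
    indicator_nonneg (fun _ _ => norm_nonneg _) _) e1
  have hrmem : r ∈ Icc 0 r := ⟨hr.le, le_rfl⟩
  have hside : ∀ {w : ℝ × ℝ}, ‖w‖ = 1 → ∀ {y : ℝ × ℝ}, dist y z ≤ 2 * r →
      IntervalIntegrable (fun t => H (y + t • w)) volume 0 r →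
      ∫ t in (0 : ℝ)..r, H (y + t • w) ≤ e → ∀ {g : ℝ × ℝ → ℝ},
      (∀ y, |g y - g z| ≤ ‖G y - G z‖) →
      IntervalIntegrable (fun t => g (y + t • w)) volume 0 r →
      ∫ t in (0 : ℝ)..r, |g (y + t • w) - g z| ≤ e := by
    intro w hw y hy hHy hHe g hgG hgy
    refine (intervalIntegral.integral_mono_on hr.le (hgy.sub intervalIntegrable_const).abs hHy
      fun t ht => ?_).trans hHe
    rw [hH, indicator_of_mem]
    · exact hgG _
    · exact (hstep hw hy t ht).trans (by linarith)
  have hcorner : ∀ {u p : ℝ → ℝ} {a : ℝ}, IsPrimitiveOn u p r →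
      ∫ t in (0 : ℝ)..r, |p t - a| ≤ e → |u r - u 0 - r * a| ≤ e := by
    intro u p a hu hp
    have : u r - u 0 - r * a = ∫ t in (0 : ℝ)..r, (p t - a) := by
      rw [intervalIntegral.integral_sub hu.1 intervalIntegrable_const, hu.2.1]
      simp
    rw [this]
    exact (intervalIntegral.abs_integral_le_integral_abs hr.le).trans hp
  have hra : ∀ {a : ℝ}, |a| ≤ M → |r * a| ≤ M * r := fun ha => by
    rw [abs_mul, abs_of_pos hr, mul_comm]
    gcongr
  have hMr : |(0 : ℝ)| ≤ M * r := by rw [abs_zero]; positivity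
  have d0 : dist x z ≤ 2 * r := by linarith
  have d1 : dist (x + r • ((1, 0) : ℝ × ℝ)) z ≤ 2 * r := by linarith [hstep n1 hxz r hrmem]
  have d2 : dist (x + r • ((0, 1) : ℝ × ℝ)) z ≤ 2 * r := by linarith [hstep n2 hxz r hrmem]
  have mem : ∀ {y : ℝ × ℝ}, dist y z ≤ 2 * r → y ∈ V := fun hy =>
    Metric.mem_ball.2 (by linarith)
  have hcon : ∀ {w : ℝ × ℝ}, ‖w‖ = 1 → ∀ {y : ℝ × ℝ}, dist y z ≤ 2 * r → ∀ {p q : ℝ → ℝ},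
      (∀ᵐ t : ℝ, y + t • w ∈ U → p t = q t) → ∀ᵐ t : ℝ, t ∈ Icc 0 r → p t = q t := by
    intro w hw y hy p q hpq
    filter_upwards [hpq] with t ht htr using ht (hVU hw y (mem hy) t htr)
  obtain ⟨⟨x11, x21, x31, xc1, xH1⟩, x12, x22, x32, xc2, xH2⟩ := gx
  obtain ⟨-, v12, v22, v32, vc2, vH2⟩ := gxv
  obtain ⟨⟨w11, w21, w31, wc1, wH1⟩, -⟩ := gxw
  have D11 := fun y => (hdev y).1
  have D12 := fun y => (hdev y).2.1
  have D21 := fun y => (hdev y).2.2.1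
  have D22 := fun y => (hdev y).2.2.2
  have x11' := hside n1 d0 xH1 e1 D11 (x11 (mem d0)).1
  have x21' := hside n1 d0 xH1 e1 D21 (x21 (mem d0)).1
  have x12' := hside n2 d0 xH2 e2 D12 (x12 (mem d0)).1
  have x22' := hside n2 d0 xH2 e2 D22 (x22 (mem d0)).1
  have v12' := hside n2 d1 vH2 e3 D12 (v12 (mem d1)).1
  have v22' := hside n2 d1 vH2 e3 D22 (v22 (mem d1)).1
  have w11' := hside n1 d2 wH1 e4 D11 (w11 (mem d2)).1
  have w21' := hside n1 d2 wH1 e4 D21 (w21 (mem d2)).1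
  have c11 := hcorner (x11 (mem d0)) x11'
  have c21 := hcorner (x21 (mem d0)) x21'
  have c12 := hcorner (x12 (mem d0)) x12'
  have c22 := hcorner (x22 (mem d0)) x22'
  simp only [zero_smul, add_zero] at c11 c21 c12 c22
  have bottom := abs_contact_increment_sub_le (F₁ := f₁ x) (F₂ := f₂ x) hr.le (x11 (mem d0))
    (x21 (mem d0)) (x31 (mem d0)) (hcon n1 d0 (xc1.mono fun t ht h => (ht h).1)) hM11 hM21 hMr hMr
    (by simpa using he0) (by simpa using he0) x11' x21'
  have left := abs_contact_increment_sub_le (F₁ := f₁ x) (F₂ := f₂ x) hr.le (x12 (mem d0))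
    (x22 (mem d0)) (x32 (mem d0)) (hcon n2 d0 (xc2.mono fun t ht h => (ht h).2)) hM12 hM22 hMr hMr
    (by simpa using he0) (by simpa using he0) x12' x22'
  have right := abs_contact_increment_sub_le (F₁ := f₁ x) (F₂ := f₂ x) hr.le (v12 (mem d1))
    (v22 (mem d1)) (v32 (mem d1)) (hcon n2 d1 (vc2.mono fun t ht h => (ht h).2)) hM12 hM22
    (hra hM11) (hra hM21) (by simpa using c11) (by simpa using c21) v12' v22'
  have top := abs_contact_increment_sub_le (F₁ := f₁ x) (F₂ := f₂ x) hr.le (w11 (mem d2))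
    (w21 (mem d2)) (w31 (mem d2)) (hcon n1 d2 (wc1.mono fun t ht h => (ht h).1)) hM11 hM21
    (hra hM12) (hra hM22) (by simpa using c12) (by simpa using c22) w11' w21'
  simp only [zero_smul, add_zero] at bottom left right top
  rw [add_right_comm x (r • ((0, 1) : ℝ × ℝ))] at top
  have hsq : r ^ 2 * |g₁₁ z * g₂₂ z - g₁₂ z * g₂₁ z| ≤ 2 * (8 * M * r * e + 4 * e ^ 2) := by
    rw [← abs_of_pos (pow_pos hr 2), ← abs_mul]
    rw [abs_le] at bottom left right top ⊢
    constructor <;> linarith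
  have hK : 2 * (8 * M * r * e + 4 * e ^ 2) ≤
      2 * (8 * M * r * (36 * ε * r) + 4 * (36 * ε * r) ^ 2) := by gcongr
  refine le_of_mul_le_mul_left ?_ (pow_pos hr 2)
  linarith

/-- A horizontal Sobolev map into the Heisenberg group has degenerate horizontal gradient almost
everywhere, for globally integrable data. -/
theorem ae_det_eq_zero {U : Set (ℝ × ℝ)} (hU : IsOpen U)
    {f₁ f₂ f₃ g₁₁ g₁₂ g₂₁ g₂₂ g₃₁ g₃₂ : ℝ × ℝ → ℝ}
    (hf : ∀ f ∈ [f₁, f₂, f₃], Integrable f ∧ Measurable f)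
    (hg : ∀ g ∈ [g₁₁, g₁₂, g₂₁, g₂₂, g₃₁, g₃₂], Integrable g ∧ Measurable g)
    (h₁₁ : IsWeakDirDeriv volume f₁ g₁₁ (1, 0) U) (h₁₂ : IsWeakDirDeriv volume f₁ g₁₂ (0, 1) U)
    (h₂₁ : IsWeakDirDeriv volume f₂ g₂₁ (1, 0) U) (h₂₂ : IsWeakDirDeriv volume f₂ g₂₂ (0, 1) U)
    (h₃₁ : IsWeakDirDeriv volume f₃ g₃₁ (1, 0) U) (h₃₂ : IsWeakDirDeriv volume f₃ g₃₂ (0, 1) U)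
    (hcontact : ∀ᵐ x, x ∈ U →
      g₃₁ x = f₁ x * g₂₁ x - f₂ x * g₁₁ x ∧ g₃₂ x = f₁ x * g₂₂ x - f₂ x * g₁₂ x) :
    ∀ᵐ x, x ∈ U → g₁₁ x * g₂₂ x - g₁₂ x * g₂₁ x = 0 := by
  have hGi : Integrable (fun x => (g₁₁ x, g₁₂ x, g₂₁ x, g₂₂ x)) :=
    (hg g₁₁ (by simp)).1.prodMk ((hg g₁₂ (by simp)).1.prodMk
      ((hg g₂₁ (by simp)).1.prodMk (hg g₂₂ (by simp)).1))
  filter_upwards [IsUnifLocDoublingMeasure.ae_tendsto_average_norm_sub volume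
    hGi.locallyIntegrable 1] with z hz hzU
  refine det_eq_zero_of_tendsto_average hU hf hg h₁₁ h₁₂ h₂₁ h₂₂ h₃₁ h₃₂ hcontact hzU rfl
    (hz (fun _ => z) id tendsto_id ?_)
  filter_upwards [self_mem_nhdsWithin] with r hr
  simpa using (mem_Ioi.1 hr).le

/-- A function integrable on `B` agrees almost everywhere on `B` with a Borel function that is
integrable on the whole space. -/
theorem MeasureTheory.IntegrableOn.exists_integrable_measurable {f : ℝ × ℝ → ℝ} {B : Set (ℝ × ℝ)}
    (hB : MeasurableSet B) (hf : IntegrableOn f B) :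
    ∃ F : ℝ × ℝ → ℝ, (Integrable F ∧ Measurable F) ∧ F =ᵐ[volume.restrict B] f := by
  refine ⟨B.indicator (hf.1.mk f), ⟨?_, hf.1.stronglyMeasurable_mk.measurable.indicator hB⟩, ?_⟩
  · rw [integrable_indicator_iff hB]
    exact hf.congr hf.1.ae_eq_mk
  · filter_upwards [ae_restrict_mem hB, hf.1.ae_eq_mk] with x hx h
    rw [indicator_of_mem hx, h]

/-- Passing from the weak derivative of a local function to that of a representative on a
smaller set. -/
theorem isWeakDirDeriv_of_ae_eq {f g F G : ℝ × ℝ → ℝ} {B Ω : Set (ℝ × ℝ)} {w : ℝ × ℝ}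
    (hBΩ : B ⊆ Ω) (hF : F =ᵐ[volume.restrict B] f) (hG : G =ᵐ[volume.restrict B] g)
    (h : ∀ φ : ℝ × ℝ → ℝ, ContDiff ℝ (⊤ : ℕ∞) φ → HasCompactSupport φ → tsupport φ ⊆ Ω →
      ∫ x in Ω, f x * fderiv ℝ φ x w = -∫ x in Ω, g x * φ x) :
    IsWeakDirDeriv volume F G w B := by
  intro φ hφ hc hs
  have key : ∀ {k K ψ : ℝ × ℝ → ℝ}, K =ᵐ[volume.restrict B] k → (∀ x ∉ B, ψ x = 0) →
      ∫ x, K x * ψ x = ∫ x in Ω, k x * ψ x := by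
    intro k K ψ hk hψ
    have hψ' : ∀ x ∉ B, ∀ l : ℝ, l * ψ x = 0 := fun x hx l => by rw [hψ x hx, mul_zero]
    rw [← setIntegral_eq_integral_of_forall_compl_eq_zero fun x hx => hψ' x hx (K x),
      setIntegral_eq_integral_of_forall_compl_eq_zero fun x hx =>
        hψ' x (fun hxB => hx (hBΩ hxB)) (k x),
      ← setIntegral_eq_integral_of_forall_compl_eq_zero fun x hx => hψ' x hx (k x)]
    exact integral_congr_ae (hk.mul EventuallyEq.rfl)
  rw [key hF fun x hx => ?_, key hG fun x hx => ?_]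
  · exact h φ hφ hc (hs.trans hBΩ)
  · exact image_eq_zero_of_notMem_tsupport fun h' => hx (hs h')
  · rw [image_eq_zero_of_notMem_tsupport (f := fderiv ℝ φ)
      fun h' => hx (hs (tsupport_fderiv_subset ℝ h'))]
    rfl

end Plane

theorem Matrix.rank_le_one_of_minor_eq_zero {a b c d k l : ℝ} (h : a * d - b * c = 0) :
    (!![a, b; c, d; k * c - l * a, k * d - l * b] : Matrix (Fin 3) (Fin 2) ℝ).rank ≤ 1 := by
  by_cases ha : a = 0
  · by_cases hb : b = 0
    · have : (!![a, b; c, d; k * c - l * a, k * d - l * b] : Matrix (Fin 3) (Fin 2) ℝ) =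
          Matrix.vecMulVec ![0, 1, k] ![c, d] := by
        ext i j
        fin_cases i <;> fin_cases j <;> simp [Matrix.vecMulVec_apply, ha, hb]
      exact this ▸ Matrix.rank_vecMulVec_le _ _
    · have hc : c = 0 := by simpa [ha, hb] using h
      have : (!![a, b; c, d; k * c - l * a, k * d - l * b] : Matrix (Fin 3) (Fin 2) ℝ) =
          Matrix.vecMulVec ![b, d, k * d - l * b] ![0, 1] := by
        ext i j
        fin_cases i <;> fin_cases j <;> simp [Matrix.vecMulVec_apply, ha, hc]
      exact this ▸ Matrix.rank_vecMulVec_le _ _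
  · have hd : d = c / a * b := by
      field_simp
      linarith
    have : (!![a, b; c, d; k * c - l * a, k * d - l * b] : Matrix (Fin 3) (Fin 2) ℝ) =
        Matrix.vecMulVec ![1, c / a, k * (c / a) - l] ![a, b] := by
      ext i j
      fin_cases i <;> fin_cases j <;> simp [Matrix.vecMulVec_apply, hd] <;> field_simp
    exact this ▸ Matrix.rank_vecMulVec_le _ _

/-- If `f = (f¹,f²,f³) ∈ W^{1,4/3}_loc(Ω, ℍ¹)` satisfies the Heisenberg contact system
`∇f³ = f¹∇f² − f²∇f¹` a.e. on `Ω`, then a.e. every 2×2 minor of the 3×2 matrix of weak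
gradients vanishes; in particular `g¹₁g²₂ − g¹₂g²₁ = 0` a.e., so the weak differential of
`f` has rank at most 1 almost everywhere in `Ω`. -/
theorem contact_implies_rank_le_one
    (Ω : Set (ℝ × ℝ)) (hΩ : IsOpen Ω)
    (f₁ f₂ f₃ g₁₁ g₁₂ g₂₁ g₂₂ g₃₁ g₃₂ : ℝ × ℝ → ℝ)
    (hf₁ : HasWeakGradientOn f₁ g₁₁ g₁₂ Ω)
    (hf₂ : HasWeakGradientOn f₂ g₂₁ g₂₂ Ω)
    (hf₃ : HasWeakGradientOn f₃ g₃₁ g₃₂ Ω)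
    (hf₁p : LocallyIntegrableOn (fun x => |f₁ x| ^ (4/3 : ℝ)) Ω volume)
    (hf₂p : LocallyIntegrableOn (fun x => |f₂ x| ^ (4/3 : ℝ)) Ω volume)
    (hf₃p : LocallyIntegrableOn (fun x => |f₃ x| ^ (4/3 : ℝ)) Ω volume)
    (hg₁₁p : LocallyIntegrableOn (fun x => |g₁₁ x| ^ (4/3 : ℝ)) Ω volume)
    (hg₁₂p : LocallyIntegrableOn (fun x => |g₁₂ x| ^ (4/3 : ℝ)) Ω volume)
    (hg₂₁p : LocallyIntegrableOn (fun x => |g₂₁ x| ^ (4/3 : ℝ)) Ω volume)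
    (hg₂₂p : LocallyIntegrableOn (fun x => |g₂₂ x| ^ (4/3 : ℝ)) Ω volume)
    (hg₃₁p : LocallyIntegrableOn (fun x => |g₃₁ x| ^ (4/3 : ℝ)) Ω volume)
    (hg₃₂p : LocallyIntegrableOn (fun x => |g₃₂ x| ^ (4/3 : ℝ)) Ω volume)
    (hcontact : ∀ᵐ x ∂(volume.restrict Ω),
      g₃₁ x = f₁ x * g₂₁ x - f₂ x * g₁₁ x ∧ g₃₂ x = f₁ x * g₂₂ x - f₂ x * g₁₂ x) :
    ∀ᵐ x ∂(volume.restrict Ω),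
      (g₁₁ x * g₂₂ x - g₁₂ x * g₂₁ x = 0 ∧
       g₁₁ x * g₃₂ x - g₁₂ x * g₃₁ x = 0 ∧
       g₂₁ x * g₃₂ x - g₂₂ x * g₃₁ x = 0) ∧
      (!![g₁₁ x, g₁₂ x; g₂₁ x, g₂₂ x; g₃₁ x, g₃₂ x] : Matrix (Fin 3) (Fin 2) ℝ).rank ≤ 1 := by
  suffices hdet : ∀ᵐ x ∂volume.restrict Ω, g₁₁ x * g₂₂ x - g₁₂ x * g₂₁ x = 0 by
    filter_upwards [hdet, hcontact] with x hx hc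
    rw [hc.1, hc.2]
    refine ⟨⟨hx, ?_, ?_⟩, Matrix.rank_le_one_of_minor_eq_zero hx⟩
    · linear_combination f₁ x * hx
    · linear_combination f₂ x * hx
  rw [ae_restrict_iff' hΩ.measurableSet] at hcontact ⊢
  refine measure_null_of_locally_null _ fun z hz => ?_
  have hzΩ : z ∈ Ω := by
    by_contra h
    exact hz fun hz' => absurd hz' h
  obtain ⟨ρ, hρ, hρΩ⟩ := Metric.nhds_basis_closedBall.mem_iff.1 (hΩ.mem_nhds hzΩ)
  set B := Metric.ball z ρ with hB
  have hBo : IsOpen B := Metric.isOpen_ball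
  have hBΩ : B ⊆ Ω := Metric.ball_subset_closedBall.trans hρΩ
  have hrep : ∀ {f : ℝ × ℝ → ℝ}, LocallyIntegrableOn f Ω volume →
      ∃ F : ℝ × ℝ → ℝ, (Integrable F ∧ Measurable F) ∧ F =ᵐ[volume.restrict B] f := fun hf =>
    IntegrableOn.exists_integrable_measurable hBo.measurableSet
      ((hf.integrableOn_compact_subset hρΩ (isCompact_closedBall _ _)).mono_set
        Metric.ball_subset_closedBall)
  obtain ⟨F₁, hF₁, eF₁⟩ := hrep hf₁.1
  obtain ⟨F₂, hF₂, eF₂⟩ := hrep hf₂.1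
  obtain ⟨F₃, hF₃, eF₃⟩ := hrep hf₃.1
  obtain ⟨G₁₁, hG₁₁, eG₁₁⟩ := hrep hf₁.2.1
  obtain ⟨G₁₂, hG₁₂, eG₁₂⟩ := hrep hf₁.2.2.1
  obtain ⟨G₂₁, hG₂₁, eG₂₁⟩ := hrep hf₂.2.1
  obtain ⟨G₂₂, hG₂₂, eG₂₂⟩ := hrep hf₂.2.2.1
  obtain ⟨G₃₁, hG₃₁, eG₃₁⟩ := hrep hf₃.2.1
  obtain ⟨G₃₂, hG₃₂, eG₃₂⟩ := hrep hf₃.2.2.1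
  have hcontactB : ∀ᵐ x, x ∈ B →
      G₃₁ x = F₁ x * G₂₁ x - F₂ x * G₁₁ x ∧ G₃₂ x = F₁ x * G₂₂ x - F₂ x * G₁₂ x := by
    rw [← ae_restrict_iff' hBo.measurableSet]
    filter_upwards [ae_restrict_of_ae hcontact, ae_restrict_mem hBo.measurableSet, eF₁, eF₂, eG₁₁,
      eG₁₂, eG₂₁, eG₂₂, eG₃₁, eG₃₂] with x hx hxB h1 h2 h3 h4 h5 h6 h7 h8
    rw [h1, h2, h3, h4, h5, h6, h7, h8]
    exact hx (hBΩ hxB)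
  have hmain := ae_det_eq_zero hBo (f₁ := F₁) (f₂ := F₂) (f₃ := F₃) (by simp [*]) (by simp [*])
    (isWeakDirDeriv_of_ae_eq hBΩ eF₁ eG₁₁ hf₁.2.2.2.1)
    (isWeakDirDeriv_of_ae_eq hBΩ eF₁ eG₁₂ hf₁.2.2.2.2)
    (isWeakDirDeriv_of_ae_eq hBΩ eF₂ eG₂₁ hf₂.2.2.2.1)
    (isWeakDirDeriv_of_ae_eq hBΩ eF₂ eG₂₂ hf₂.2.2.2.2)
    (isWeakDirDeriv_of_ae_eq hBΩ eF₃ eG₃₁ hf₃.2.2.2.1)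
    (isWeakDirDeriv_of_ae_eq hBΩ eF₃ eG₃₂ hf₃.2.2.2.2) hcontactB
  rw [← ae_restrict_iff' hBo.measurableSet] at hmain
  have hB0 : ∀ᵐ x, x ∈ B → g₁₁ x * g₂₂ x - g₁₂ x * g₂₁ x = 0 := by
    rw [← ae_restrict_iff' hBo.measurableSet]
    filter_upwards [hmain, eG₁₁, eG₁₂, eG₂₁, eG₂₂] with x hx h1 h2 h3 h4
    rwa [h1, h2, h3, h4] at hx
  refine ⟨_, inter_mem_nhdsWithin _ (Metric.ball_mem_nhds z hρ), measure_mono_null ?_ hB0⟩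
  rintro x ⟨hx, hxB⟩ h
  exact hx fun _ => h hxB
end

section
/- Let Ω ⊆ ℝ² be an open set and let f¹, f², f³ : ℝ² → ℝ have weak gradients g¹, g², g³ on Ω respectively, with f¹, f² locally L⁴ on Ω, g¹, g² locally L^{4/3} on Ω, and f³, g³ locally integrable on Ω. Suppose the contact system g³(x) = f¹(x)·g²(x) − f²(x)·g¹(x) holds for Lebesgue-almost every x ∈ Ω. Then the distributional Jacobian of F = (f¹, f²) vanishes: for every smooth function φ : ℝ² → ℝ with compact support contained in Ω, ∫_Ω f¹(x)·(∂₁φ(x)·g²₂(x) − ∂₂φ(x)·g²₁(x)) dL²(x) = 0. -/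
open MeasureTheory
open scoped ENNReal

section SmoothFunctions

variable {E : Type*} [NormedAddCommGroup E] [NormedSpace ℝ E]

lemma ContDiff.fderiv_apply_const {φ : E → ℝ} (hφ : ContDiff ℝ (⊤ : ℕ∞) φ) (v : E) :
    ContDiff ℝ (⊤ : ℕ∞) fun x => fderiv ℝ φ x v :=
  (hφ.fderiv_right (m := (⊤ : ℕ∞)) (by simp)).clm_apply contDiff_const

lemma exists_contDiff_cutoff [FiniteDimensional ℝ E] {K Ω : Set E}
    (hK : IsCompact K) (hΩ : IsOpen Ω) (hKΩ : K ⊆ Ω) :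
    ∃ χ : E → ℝ, ContDiff ℝ (⊤ : ℕ∞) χ ∧ HasCompactSupport χ ∧ tsupport χ ⊆ Ω ∧
      ∀ x ∈ K, χ =ᶠ[nhds x] fun _ => 1 := by
  obtain ⟨L, hL, hKL, hLΩ⟩ := exists_compact_between hK hΩ hKΩ
  obtain ⟨χ, h1, h0, -⟩ := exists_contMDiffMap_one_nhds_of_subset_interior
    (n := (⊤ : ℕ∞)) (modelWithCornersSelf ℝ E) hK.isClosed hKL
  have hs : tsupport χ ⊆ L := closure_minimal
    (fun x hx => by_contra fun hxL => hx (h0 x hxL)) hL.isClosed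
  exact ⟨χ, χ.contMDiff.contDiff, hL.of_isClosed_subset (isClosed_tsupport _) hs,
    hs.trans hLΩ, fun x hx => h1.filter_mono (nhds_le_nhdsSet hx)⟩

end SmoothFunctions

section WeakDerivative

variable {E : Type*} [NormedAddCommGroup E] [MeasurableSpace E] {μ : Measure E}

/-- `f` is `L^p` on every compact subset of `Ω`. -/
def MemLpLocOn (μ : Measure E) (f : E → ℝ) (p : ℝ≥0∞) (Ω : Set E) : Prop :=
  ∀ K ⊆ Ω, IsCompact K → MemLp f p (μ.restrict K)

lemma MemLpLocOn.mul {f g : E → ℝ} {p q : ℝ≥0∞} {Ω : Set E} [p.HolderConjugate q]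
    (hf : MemLpLocOn μ f p Ω) (hg : MemLpLocOn μ g q Ω) :
    MemLpLocOn μ (fun x => f x * g x) 1 Ω :=
  fun K hK hKc => (hg K hK hKc).mul (hf K hK hKc)

lemma MemLpLocOn.add {f g : E → ℝ} {p : ℝ≥0∞} {Ω : Set E}
    (hf : MemLpLocOn μ f p Ω) (hg : MemLpLocOn μ g p Ω) :
    MemLpLocOn μ (fun x => f x + g x) p Ω :=
  fun K hK hKc => (hf K hK hKc).add (hg K hK hKc)

lemma MemLpLocOn.one_of_locallyIntegrableOn {f : E → ℝ} {Ω : Set E}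
    (hf : LocallyIntegrableOn f Ω μ) : MemLpLocOn μ f 1 Ω :=
  fun _ hK hKc => memLp_one_iff_integrable.2 (hf.integrableOn_compact_subset hK hKc)

lemma MemLpLocOn.of_locallyIntegrableOn {f : E → ℝ} {Ω : Set E} {p : ℝ≥0∞}
    (hp0 : p ≠ 0) (hp : p ≠ ∞) (hf : LocallyIntegrableOn f Ω μ)
    (hfp : LocallyIntegrableOn (fun x => |f x| ^ p.toReal) Ω μ) : MemLpLocOn μ f p Ω :=
  fun _ hK hKc => (integrable_norm_rpow_iff
    (hf.integrableOn_compact_subset hK hKc).aestronglyMeasurable hp0 hp).1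
      (hfp.integrableOn_compact_subset hK hKc)

lemma setIntegral_mul_eq_integral_of_tsupport_subset {a f : E → ℝ} {Ω : Set E}
    (ha : tsupport a ⊆ Ω) : ∫ x in Ω, a x * f x ∂μ = ∫ x, a x * f x ∂μ := by
  refine setIntegral_eq_integral_of_forall_compl_eq_zero fun x hx => ?_
  rw [image_eq_zero_of_notMem_tsupport fun h => hx (ha h), zero_mul]

lemma MemLpLocOn.mono_exponent [IsFiniteMeasureOnCompacts μ] {f : E → ℝ} {p q : ℝ≥0∞} {Ω : Set E}
    (hf : MemLpLocOn μ f p Ω) (hqp : q ≤ p) : MemLpLocOn μ f q Ω := by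
  intro K hK hKc
  have : IsFiniteMeasure (μ.restrict K) := ⟨by simpa using hKc.measure_lt_top⟩
  exact (hf K hK hKc).mono_exponent hqp

lemma MemLpLocOn.memLp_mul [BorelSpace E] {a f : E → ℝ} {p : ℝ≥0∞} {Ω : Set E}
    (hf : MemLpLocOn μ f p Ω) (ha : Continuous a) (hac : HasCompactSupport a) (haΩ : tsupport a ⊆ Ω) :
    MemLp (fun x => a x * f x) p μ := by
  obtain ⟨C, hC⟩ := ha.bounded_above_of_compact_support hac
  have hind : (fun x => a x * f x) = (tsupport a).indicator (a * f) := by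
    ext x
    by_cases hx : x ∈ tsupport a
    · simp [hx]
    · simp [hx, image_eq_zero_of_notMem_tsupport hx]
  rw [hind, memLp_indicator_iff_restrict (isClosed_tsupport a).measurableSet]
  exact (hf _ haΩ hac).mul (p := ∞)
    (memLp_top_of_bound ha.aestronglyMeasurable C (.of_forall hC))

lemma MemLpLocOn.integrable_mul [BorelSpace E] {a f : E → ℝ} {Ω : Set E} (hf : MemLpLocOn μ f 1 Ω)
    (ha : Continuous a) (hac : HasCompactSupport a) (haΩ : tsupport a ⊆ Ω) :
    Integrable (fun x => a x * f x) μ :=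
  memLp_one_iff_integrable.1 (hf.memLp_mul ha hac haΩ)

variable [NormedSpace ℝ E]

/-- `g` is a weak derivative of `u` in the direction `v` on `Ω`. -/
def IsWeakLineDerivOn (μ : Measure E) (u g : E → ℝ) (v : E) (Ω : Set E) : Prop :=
  ∀ φ : E → ℝ, ContDiff ℝ (⊤ : ℕ∞) φ → HasCompactSupport φ → tsupport φ ⊆ Ω →
    ∫ x in Ω, u x * fderiv ℝ φ x v ∂μ = -∫ x in Ω, g x * φ x ∂μ

/-- Weak gradients are curl-free in the sense of distributions. -/
lemma IsWeakLineDerivOn.setIntegral_mul_fderiv_comm {u g h φ : E → ℝ} {v w : E} {Ω : Set E}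
    (hg : IsWeakLineDerivOn μ u g v Ω) (hh : IsWeakLineDerivOn μ u h w Ω)
    (hφ : ContDiff ℝ (⊤ : ℕ∞) φ) (hφc : HasCompactSupport φ) (hφΩ : tsupport φ ⊆ Ω) :
    ∫ x in Ω, h x * fderiv ℝ φ x v ∂μ = ∫ x in Ω, g x * fderiv ℝ φ x w ∂μ := by
  have hsymm : ∀ x, fderiv ℝ (fun y => fderiv ℝ φ y v) x w
      = fderiv ℝ (fun y => fderiv ℝ φ y w) x v := by
    intro x
    have hd : DifferentiableAt ℝ (fderiv ℝ φ) x :=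
      (hφ.fderiv_right (m := (⊤ : ℕ∞)) (by simp)).differentiable (by simp) x
    rw [fderiv_clm_apply hd (differentiableAt_const v),
      fderiv_clm_apply hd (differentiableAt_const w)]
    simpa using hφ.contDiffAt.isSymmSndFDerivAt
      (by simpa using WithTop.coe_le_coe.2 (le_top : (2 : ℕ∞) ≤ ⊤)) w v
  have h₁ := hg _ (hφ.fderiv_apply_const w) (hφc.fderiv_apply ℝ w)
    ((tsupport_fderiv_apply_subset ℝ w).trans hφΩ)
  have h₂ := hh _ (hφ.fderiv_apply_const v) (hφc.fderiv_apply ℝ v)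
    ((tsupport_fderiv_apply_subset ℝ v).trans hφΩ)
  simp only [hsymm] at h₂
  exact neg_inj.1 (h₂.symm.trans h₁)

lemma IsWeakLineDerivOn.mul_cutoff [BorelSpace E]
    {u g χ : E → ℝ} {v : E} {Ω : Set E} (h : IsWeakLineDerivOn μ u g v Ω)
    (hu : MemLpLocOn μ u 1 Ω) (hg : MemLpLocOn μ g 1 Ω)
    (hχ : ContDiff ℝ (⊤ : ℕ∞) χ) (hχc : HasCompactSupport χ) (hχΩ : tsupport χ ⊆ Ω) :
    IsWeakLineDerivOn μ (fun x => χ x * u x) (fun x => χ x * g x + fderiv ℝ χ x v * u x) v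
      Set.univ := by
  intro φ hφ hφc _
  have hdχ : Continuous fun x => fderiv ℝ χ x v := (hχ.fderiv_apply_const v).continuous
  have hdφ : Continuous fun x => fderiv ℝ φ x v := (hφ.fderiv_apply_const v).continuous
  have hχφ : tsupport (fun x => χ x * φ x) ⊆ Ω := tsupport_mul_subset_left.trans hχΩ
  have hχdφ : tsupport (fun x => χ x * fderiv ℝ φ x v) ⊆ Ω :=
    tsupport_mul_subset_left.trans hχΩ
  have hdχφ : tsupport (fun x => fderiv ℝ χ x v * φ x) ⊆ Ω :=
    (tsupport_mul_subset_left.trans (tsupport_fderiv_apply_subset ℝ v)).trans hχΩ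
  have h_int₁ : Integrable (fun x => χ x * fderiv ℝ φ x v * u x) μ :=
    hu.integrable_mul (hχ.continuous.mul hdφ) hχc.mul_right hχdφ
  have h_int₂ : Integrable (fun x => fderiv ℝ χ x v * φ x * u x) μ :=
    hu.integrable_mul (hdχ.mul hφ.continuous) hφc.mul_left hdχφ
  have h_int₃ : Integrable (fun x => χ x * φ x * g x) μ :=
    hg.integrable_mul (hχ.continuous.mul hφ.continuous) hχc.mul_right hχφ
  have hw := h (fun x => χ x * φ x) (hχ.mul hφ) hχc.mul_right hχφ
  have hd : ∀ x, fderiv ℝ (fun x => χ x * φ x) x v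
      = χ x * fderiv ℝ φ x v + fderiv ℝ χ x v * φ x := by
    intro x
    rw [fderiv_fun_mul (hχ.differentiable (by simp) x) (hφ.differentiable (by simp) x)]
    simp [mul_comm]
  simp_rw [hd, mul_comm (u _), mul_comm (g _), add_mul] at hw
  rw [integral_add h_int₁.integrableOn h_int₂.integrableOn,
    setIntegral_mul_eq_integral_of_tsupport_subset hχdφ,
    setIntegral_mul_eq_integral_of_tsupport_subset hdχφ,
    setIntegral_mul_eq_integral_of_tsupport_subset hχφ] at hw
  have hsum : ∫ x, (χ x * g x + fderiv ℝ χ x v * u x) * φ x ∂μ =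
      (∫ x, χ x * φ x * g x ∂μ) + ∫ x, fderiv ℝ χ x v * φ x * u x ∂μ := by
    rw [← integral_add h_int₃ h_int₂]
    exact integral_congr_ae (.of_forall fun x => by ring)
  simp_rw [setIntegral_univ, mul_right_comm (χ _) (u _), hsum]
  linarith

variable [BorelSpace E] [FiniteDimensional ℝ E]

lemma integrable_mul_mul_sub [SFinite μ] {F G η : E → ℝ} (hF : Integrable F μ) (hG : Integrable G μ)
    (hη : Continuous η) (hηc : HasCompactSupport η) :
    Integrable (fun z : E × E => F z.1 * (G z.2 * η (z.2 - z.1))) (μ.prod μ) := by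
  obtain ⟨C, hC⟩ := hη.bounded_above_of_compact_support hηc
  refine ((hF.mul_prod hG).mul_bdd (g := fun z : E × E => η (z.2 - z.1)) (c := C)
    (by fun_prop) (.of_forall fun z => hC _)).congr (.of_forall fun z => ?_)
  simp [mul_assoc]

variable [μ.IsAddHaarMeasure]

lemma continuous_integral_mul_translate {F G : E → ℝ} {p q : ℝ≥0∞} [p.HolderConjugate q]
    (hq : q ≠ ∞) (hF : MemLp F p μ) (hG : MemLp G q μ) :
    Continuous fun t => ∫ x, F x * G (x + t) ∂μ := by
  have : Fact (1 ≤ p) := ⟨ENNReal.HolderConjugate.one_le p q⟩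
  have : Fact (1 ≤ q) := ⟨ENNReal.HolderConjugate.one_le q p⟩
  have : Fact (q ≠ ∞) := ⟨hq⟩
  have key : ∀ t, ∫ x, F x * G (x + t) ∂μ =
      (ContinuousLinearMap.mul ℝ ℝ).lpPairing μ p q hF.toLp
        (DomAddAct.mk t +ᵥ hG.toLp) := by
    intro t
    rw [ContinuousLinearMap.lpPairing_eq_integral, DomAddAct.mk_vadd_toLp]
    refine integral_congr_ae ?_
    filter_upwards [hF.coeFn_toLp, MemLp.coeFn_toLp
      (hG.comp_measurePreserving (measurePreserving_vadd t μ))] with x h1 h2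
    rw [h1, ContinuousLinearMap.mul_apply', add_comm x t]
    exact congrArg (F x * ·) h2.symm
  simp_rw [key]
  have hc : Continuous fun t : E => (DomAddAct.mk t +ᵥ hG.toLp : Lp ℝ q μ) :=
    DomAddAct.continuous_mk.vadd continuous_const
  exact (ContinuousLinearMap.continuous _).comp hc

lemma integral_mul_integral_translate {F G η : E → ℝ} (hF : Integrable F μ) (hG : Integrable G μ)
    (hη : Continuous η) (hηc : HasCompactSupport η) :
    ∫ t, η t * ∫ x, F x * G (x + t) ∂μ ∂μ = ∫ x, F x * ∫ y, G y * η (y - x) ∂μ ∂μ := by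
  obtain ⟨C, hC⟩ := hη.bounded_above_of_compact_support hηc
  have h_int : Integrable (fun z : E × E => η z.2 * (F z.1 * G (z.1 + z.2))) (μ.prod μ) :=
    ((measurePreserving_prod_add μ μ).integrable_comp_of_integrable (hF.mul_prod hG)).bdd_mul
      (by fun_prop) (.of_forall fun z => hC z.2)
  simp_rw [← integral_const_mul]
  rw [← integral_integral_swap h_int]
  refine integral_congr_ae (.of_forall fun x => ?_)
  dsimp only
  rw [← integral_sub_right_eq_self _ x]
  refine integral_congr_ae (.of_forall fun y => ?_)
  simp only [add_sub_cancel]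
  ring

/-- Integration by parts for functions with globally `L^p` values and `L^q` weak derivatives,
where `p` and `q` are conjugate. -/
lemma IsWeakLineDerivOn.integral_mul_add_mul_eq_zero {F F' G G' : E → ℝ} {v : E} {p q : ℝ≥0∞}
    [p.HolderConjugate q] (hp : p ≠ ∞) (hq : q ≠ ∞)
    (hFw : IsWeakLineDerivOn μ F F' v Set.univ) (hGw : IsWeakLineDerivOn μ G G' v Set.univ)
    (hF : MemLp F p μ) (hF' : MemLp F' q μ) (hG : MemLp G p μ) (hG' : MemLp G' q μ)
    (hF₁ : Integrable F μ) (hF'₁ : Integrable F' μ)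
    (hG₁ : Integrable G μ) (hG'₁ : Integrable G' μ) :
    ∫ x, (F x * G' x + F' x * G x) ∂μ = 0 := by
  have hcFG' := continuous_integral_mul_translate hq hF hG'
  have hcF'G := continuous_integral_mul_translate hp hF' hG
  have hc : Continuous fun t => (∫ x, F x * G' (x + t) ∂μ) + ∫ x, F' x * G (x + t) ∂μ :=
    hcFG'.add hcF'G
  have hae := ae_eq_zero_of_integral_contDiff_smul_eq_zero (μ := μ) hc.locallyIntegrable (by
    intro η hη hηc
    have h1 : ∀ x, ∫ y, G' y * η (y - x) ∂μ = -∫ y, G y * fderiv ℝ η (y - x) v ∂μ := by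
      intro x
      have := hGw (fun y => η (y - x)) (by fun_prop)
        (hηc.comp_homeomorph (Homeomorph.subRight x)) (Set.subset_univ _)
      simp only [fderiv_comp_sub, setIntegral_univ] at this
      rw [this, neg_neg]
    have h2 : ∀ y, ∫ x, F' x * η (y - x) ∂μ = ∫ x, F x * fderiv ℝ η (y - x) v ∂μ := by
      intro y
      have := hFw (fun x => η (y - x)) (by fun_prop)
        (hηc.comp_homeomorph (Homeomorph.subLeft y)) (Set.subset_univ _)
      have hd : ∀ x, fderiv ℝ (fun x => η (y - x)) x v = - fderiv ℝ η (y - x) v := by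
        intro x
        have hcomp : HasFDerivAt (fun x => η (y - x)) _ x :=
          (hη.differentiable (by simp) (y - x)).hasFDerivAt.comp x ((hasFDerivAt_id x).const_sub y)
        simp [hcomp.fderiv]
      simp only [hd, setIntegral_univ, mul_neg, integral_neg, neg_inj] at this
      exact this.symm
    have hdη : Continuous fun x => fderiv ℝ η x v := (hη.fderiv_apply_const v).continuous
    have hdηc : HasCompactSupport fun x => fderiv ℝ η x v := hηc.fderiv_apply ℝ v
    simp only [smul_eq_mul, mul_add]
    rw [integral_add, integral_mul_integral_translate hF₁ hG'₁ hη.continuous hηc,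
      integral_mul_integral_translate hF'₁ hG₁ hη.continuous hηc]
    · have e : ∫ x, F' x * ∫ y, G y * η (y - x) ∂μ ∂μ =
          ∫ x, F x * ∫ y, G y * fderiv ℝ η (y - x) v ∂μ ∂μ := by
        have e₁ := integral_integral_swap (f := fun x y => F' x * (G y * η (y - x)))
          (integrable_mul_mul_sub hF'₁ hG₁ hη.continuous hηc)
        have e₂ := integral_integral_swap (f := fun x y => F x * (G y * fderiv ℝ η (y - x) v))
          (integrable_mul_mul_sub hF₁ hG₁ hdη hdηc)
        simp_rw [← integral_const_mul]
        rw [e₁, e₂]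
        simp_rw [mul_left_comm _ (G _), integral_const_mul, h2]
      rw [e]
      simp [h1, integral_neg]
    · exact (hη.continuous.mul hcFG').integrable_of_hasCompactSupport hηc.mul_right
    · exact (hη.continuous.mul hcF'G).integrable_of_hasCompactSupport hηc.mul_right)
  have h0 := congrFun (hc.ae_eq_iff_eq μ continuous_const |>.1 hae) 0
  simp only [add_zero] at h0
  exact (integral_add (hF.integrable_mul hG') (hF'.integrable_mul hG)).trans h0

/-- The Leibniz rule for weak derivatives. -/
lemma IsWeakLineDerivOn.mul {f₁ g₁ f₂ g₂ : E → ℝ} {v : E} {Ω : Set E} {p q : ℝ≥0∞}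
    [p.HolderConjugate q] (hp : p ≠ ∞) (hqp : q ≤ p) (hΩ : IsOpen Ω)
    (h₁ : IsWeakLineDerivOn μ f₁ g₁ v Ω) (h₂ : IsWeakLineDerivOn μ f₂ g₂ v Ω)
    (hf₁ : MemLpLocOn μ f₁ p Ω) (hg₁ : MemLpLocOn μ g₁ q Ω)
    (hf₂ : MemLpLocOn μ f₂ p Ω) (hg₂ : MemLpLocOn μ g₂ q Ω) :
    IsWeakLineDerivOn μ (fun x => f₁ x * f₂ x) (fun x => f₁ x * g₂ x + f₂ x * g₁ x) v Ω := by
  intro ψ hψ hψc hψΩ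
  obtain ⟨χ, hχ, hχc, hχΩ, hχ1⟩ := exists_contDiff_cutoff hψc hΩ hψΩ
  have hq1 : 1 ≤ q := ENNReal.HolderConjugate.one_le q p
  have hmem : ∀ {a f g : E → ℝ} {r : ℝ≥0∞}, r ≤ q → ContDiff ℝ (⊤ : ℕ∞) a →
      HasCompactSupport a → tsupport a ⊆ Ω → MemLpLocOn μ f p Ω → MemLpLocOn μ g q Ω →
      MemLp (fun x => a x * g x + fderiv ℝ a x v * f x) r μ := fun hr ha hac haΩ hf hg =>
    ((hg.mono_exponent hr).memLp_mul ha.continuous hac haΩ).add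
      ((hf.mono_exponent (hr.trans hqp)).memLp_mul (ha.fderiv_apply_const v).continuous
        (hac.fderiv_apply ℝ v) ((tsupport_fderiv_apply_subset ℝ v).trans haΩ))
  have hf₁' := hf₁.mono_exponent (hq1.trans hqp)
  have hf₂' := hf₂.mono_exponent (hq1.trans hqp)
  have key := IsWeakLineDerivOn.integral_mul_add_mul_eq_zero hp (ne_top_of_le_ne_top hp hqp)
    (h₁.mul_cutoff hf₁' (hg₁.mono_exponent hq1) hχ hχc hχΩ)
    (h₂.mul_cutoff hf₂' (hg₂.mono_exponent hq1) hψ hψc hψΩ)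
    (hf₁.memLp_mul hχ.continuous hχc hχΩ) (hmem le_rfl hχ hχc hχΩ hf₁ hg₁)
    (hf₂.memLp_mul hψ.continuous hψc hψΩ) (hmem le_rfl hψ hψc hψΩ hf₂ hg₂)
    (hf₁'.integrable_mul hχ.continuous hχc hχΩ)
    (memLp_one_iff_integrable.1 (hmem hq1 hχ hχc hχΩ hf₁ hg₁))
    (hf₂'.integrable_mul hψ.continuous hψc hψΩ)
    (memLp_one_iff_integrable.1 (hmem hq1 hψ hψc hψΩ hf₂ hg₂))
  have hpt : ∀ x, χ x * f₁ x * (ψ x * g₂ x + fderiv ℝ ψ x v * f₂ x)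
      + (χ x * g₁ x + fderiv ℝ χ x v * f₁ x) * (ψ x * f₂ x)
      = fderiv ℝ ψ x v * (f₁ x * f₂ x) + ψ x * (f₁ x * g₂ x + f₂ x * g₁ x) := by
    intro x
    by_cases hx : x ∈ tsupport ψ
    · rw [(hχ1 x hx).fderiv_eq, (hχ1 x hx).self_of_nhds]
      simp
      ring
    · have hdx : fderiv ℝ ψ x v = 0 := image_eq_zero_of_notMem_tsupport
        (f := fun x => fderiv ℝ ψ x v) fun h => hx (tsupport_fderiv_apply_subset ℝ v h)
      simp [image_eq_zero_of_notMem_tsupport hx, hdx]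
  have hdψΩ := (tsupport_fderiv_apply_subset (f := ψ) ℝ v).trans hψΩ
  have hfg : MemLpLocOn μ (fun x => f₁ x * g₂ x + f₂ x * g₁ x) 1 Ω :=
    (hf₁.mul hg₂).add (hf₂.mul hg₁)
  simp_rw [hpt] at key
  rw [integral_add ((hf₁.mul (hf₂.mono_exponent hqp)).integrable_mul
      (hψ.fderiv_apply_const v).continuous (hψc.fderiv_apply ℝ v) hdψΩ)
    (hfg.integrable_mul hψ.continuous hψc hψΩ)] at key
  simp_rw [mul_comm (f₁ _ * f₂ _), mul_comm (f₁ _ * g₂ _ + _)]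
  rw [setIntegral_mul_eq_integral_of_tsupport_subset hdψΩ,
    setIntegral_mul_eq_integral_of_tsupport_subset hψΩ]
  exact eq_neg_of_add_eq_zero_left key

end WeakDerivative

/-- If `f¹, f²` are locally `L⁴` with weak gradients `g¹, g²` locally `L^{4/3}` on `Ω`,
`f³, g³` are locally integrable, and the Heisenberg contact system
`∇f³ = f¹∇f² − f²∇f¹` holds a.e. on `Ω`, then the distributional Jacobian of
`F = (f¹, f²)` vanishes: `⟨J_F, φ⟩ = −∫_Ω f¹ dφ ∧ df² = 0` for all test functions `φ`. -/
theorem contact_implies_distributional_jacobian_zero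
    (Ω : Set (ℝ × ℝ)) (hΩ : IsOpen Ω)
    (f₁ f₂ f₃ g₁₁ g₁₂ g₂₁ g₂₂ g₃₁ g₃₂ : ℝ × ℝ → ℝ)
    (hf₁ : HasWeakGradientOn f₁ g₁₁ g₁₂ Ω)
    (hf₂ : HasWeakGradientOn f₂ g₂₁ g₂₂ Ω)
    (hf₃ : HasWeakGradientOn f₃ g₃₁ g₃₂ Ω)
    (hf₁p : LocallyIntegrableOn (fun x => |f₁ x| ^ (4 : ℝ)) Ω volume)
    (hf₂p : LocallyIntegrableOn (fun x => |f₂ x| ^ (4 : ℝ)) Ω volume)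
    (hg₁₁p : LocallyIntegrableOn (fun x => |g₁₁ x| ^ (4/3 : ℝ)) Ω volume)
    (hg₁₂p : LocallyIntegrableOn (fun x => |g₁₂ x| ^ (4/3 : ℝ)) Ω volume)
    (hg₂₁p : LocallyIntegrableOn (fun x => |g₂₁ x| ^ (4/3 : ℝ)) Ω volume)
    (hg₂₂p : LocallyIntegrableOn (fun x => |g₂₂ x| ^ (4/3 : ℝ)) Ω volume)
    (hcontact : ∀ᵐ x ∂(volume.restrict Ω),
      g₃₁ x = f₁ x * g₂₁ x - f₂ x * g₁₁ x ∧ g₃₂ x = f₁ x * g₂₂ x - f₂ x * g₁₂ x) :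
    ∀ φ : ℝ × ℝ → ℝ, ContDiff ℝ (⊤ : ℕ∞) φ → HasCompactSupport φ → tsupport φ ⊆ Ω →
      ∫ x in Ω, f₁ x * (fderiv ℝ φ x (1, 0) * g₂₂ x - fderiv ℝ φ x (0, 1) * g₂₁ x) = 0 := by
  intro φ hφ hφc hφΩ
  obtain ⟨hf₁i, hg₁₁i, hg₁₂i, hf₁x, hf₁y⟩ := hf₁
  obtain ⟨hf₂i, hg₂₁i, hg₂₂i, hf₂x, hf₂y⟩ := hf₂
  obtain ⟨-, hg₃₁i, hg₃₂i, hf₃x, hf₃y⟩ := hf₃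
  have hconj : ENNReal.HolderConjugate 4 (4 / 3) := by
    refine ENNReal.HolderTriple.of_toReal ?_
    have : Real.HolderConjugate 4 (4 / 3) := Real.holderConjugate_iff.2 (by norm_num)
    simpa using this
  have hle : (4 / 3 : ℝ≥0∞) ≤ 4 := ENNReal.div_le_of_le_mul (by norm_num)
  have hmem₄ : ∀ {f : ℝ × ℝ → ℝ}, LocallyIntegrableOn f Ω volume →
      LocallyIntegrableOn (fun x => |f x| ^ (4 : ℝ)) Ω volume → MemLpLocOn volume f 4 Ω :=
    fun hf hfp => MemLpLocOn.of_locallyIntegrableOn (by simp) (by simp) hf (by simpa using hfp)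
  have hmem : ∀ {g : ℝ × ℝ → ℝ}, LocallyIntegrableOn g Ω volume →
      LocallyIntegrableOn (fun x => |g x| ^ (4 / 3 : ℝ)) Ω volume →
      MemLpLocOn volume g (4 / 3) Ω :=
    fun hg hgp => MemLpLocOn.of_locallyIntegrableOn (by simp)
      (ne_top_of_le_ne_top (by simp) hle) hg (by simpa using hgp)
  have hF₁ := hmem₄ hf₁i hf₁p
  have hF₂ := hmem₄ hf₂i hf₂p
  have hG₁₁ := hmem hg₁₁i hg₁₁p
  have hG₁₂ := hmem hg₁₂i hg₁₂p
  have hG₂₁ := hmem hg₂₁i hg₂₁p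
  have hG₂₂ := hmem hg₂₂i hg₂₂p
  have hprod := (IsWeakLineDerivOn.mul (by simp) hle hΩ hf₁x hf₂x hF₁ hG₁₁ hF₂ hG₂₁)
    |>.setIntegral_mul_fderiv_comm (IsWeakLineDerivOn.mul (by simp) hle hΩ hf₁y hf₂y
      hF₁ hG₁₂ hF₂ hG₂₂) hφ hφc hφΩ
  have hcurl := IsWeakLineDerivOn.setIntegral_mul_fderiv_comm hf₃x hf₃y hφ hφc hφΩ
  have h_int : ∀ {g : ℝ × ℝ → ℝ}, MemLpLocOn volume g 1 Ω → ∀ v : ℝ × ℝ,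
      IntegrableOn (fun x => g x * fderiv ℝ φ x v) Ω := fun hg v => by
    simpa only [mul_comm] using (hg.integrable_mul (hφ.fderiv_apply_const v).continuous
      (hφc.fderiv_apply ℝ v) ((tsupport_fderiv_apply_subset ℝ v).trans hφΩ)).integrableOn
  have hP₁ := h_int ((hF₁.mul hG₂₁).add (hF₂.mul hG₁₁)) (0, 1)
  have hP₂ := h_int ((hF₁.mul hG₂₂).add (hF₂.mul hG₁₂)) (1, 0)
  have hQ₁ := h_int (MemLpLocOn.one_of_locallyIntegrableOn hg₃₁i) (0, 1)
  have hQ₂ := h_int (MemLpLocOn.one_of_locallyIntegrableOn hg₃₂i) (1, 0)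
  have hsplit := integral_add (hP₂.sub hP₁) (hQ₂.sub hQ₁)
  simp only [Pi.sub_apply] at hsplit
  rw [integral_sub hP₂ hP₁, integral_sub hQ₂ hQ₁, hprod, hcurl, sub_self, sub_self,
    add_zero] at hsplit
  have hdouble : ∫ x in Ω,
      2 * (f₁ x * (fderiv ℝ φ x (1, 0) * g₂₂ x - fderiv ℝ φ x (0, 1) * g₂₁ x)) = 0 := by
    refine (integral_congr_ae ?_).trans hsplit
    filter_upwards [hcontact] with x hx
    rw [hx.1, hx.2]
    ring
  rw [integral_const_mul] at hdouble
  simpa using hdouble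
end
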